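/- Let f be a Gaussian random field on ℝ with mean function m and covariance function k such that m is differentiable and k is twice continuously differentiable. Then there exists a real-valued random field Df on ℝ such that for each fixed x ∈ ℝ, the difference quotients (f(x+δ) − f(x))/δ converge to Df(x) in mean square (in L²(Ω)) as δ → 0, i.e., E[|(f(x+δ) − f(x))/δ − Df(x)|²] → 0 as δ → 0. -/

import Mathlib

open MeasureTheory ProbabilityTheory Filter Topology
open scoped NNReal

/-- A real random variable has a (possibly degenerate) Gaussian distribution. -/
def IsGaussianRV {Ω : Type*} [MeasurableSpace Ω] (P : Measure Ω) (ξ : Ω → ℝ) : Prop :=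
  Measurable ξ ∧ ∃ (μ : ℝ) (v : ℝ≥0), Measure.map ξ P = gaussianReal μ v

/-- A Gaussian random field on a set `X`: every finite linear combination of its
values is a (possibly degenerate) Gaussian random variable. -/
def IsGaussianRF {Ω : Type*} [MeasurableSpace Ω] (P : Measure Ω) {X : Type*}
    (f : X → Ω → ℝ) : Prop :=
  (∀ x, Measurable (f x)) ∧
  ∀ (p : ℕ) (x : Fin p → X) (c : Fin p → ℝ),
    IsGaussianRV P (fun ω => ∑ i, c i * f (x i) ω)

/-- `Df` is the derivative random field of `f`: at every point, the difference
quotients of `f` converge to `Df` in mean square. -/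
def IsDerivField {Ω : Type*} [MeasurableSpace Ω] (P : Measure Ω)
    (f Df : ℝ → Ω → ℝ) : Prop :=
  (∀ x, Measurable (Df x)) ∧
  ∀ x : ℝ, Tendsto (fun δ : ℝ => ∫ ω, ((f (x + δ) ω - f x ω) / δ - Df x ω) ^ 2 ∂P)
    (𝓝[≠] 0) (𝓝 0)

/-- A Gaussian random variable is square-integrable. -/
theorem IsGaussianRV.memLp_two {Ω : Type*} [MeasurableSpace Ω] {P : Measure Ω} {ξ : Ω → ℝ}
    (h : IsGaussianRV P ξ) : MemLp ξ 2 P := by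
  obtain ⟨hξ, μ, v, hmap⟩ := h
  have hid : MemLp id 2 (Measure.map ξ P) := by
    rw [hmap]
    exact_mod_cast memLp_id_gaussianReal (μ := μ) (v := v) 2
  exact (memLp_map_measure_iff hid.1 hξ.aemeasurable).1 hid

theorem IsGaussianRF.memLp_two {Ω : Type*} [MeasurableSpace Ω] {P : Measure Ω} {X : Type*}
    {f : X → Ω → ℝ} (hf : IsGaussianRF P f) (x : X) : MemLp (f x) 2 P := by
  simpa using (hf.2 1 (fun _ => x) (fun _ => 1)).memLp_two

/-- The second mixed difference quotient of a `C²` function converges to the mixed derivative. -/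
theorem ContDiff.exists_tendsto_mixed_difference_quotient {k : ℝ → ℝ → ℝ}
    (hk : ContDiff ℝ 2 (fun p : ℝ × ℝ => k p.1 p.2)) (x y : ℝ) :
    ∃ L : ℝ, Tendsto (fun p : ℝ × ℝ =>
      (k (x + p.1) (y + p.2) - k (x + p.1) y - k x (y + p.2) + k x y) / (p.1 * p.2))
      (𝓝[≠] 0 ×ˢ 𝓝[≠] 0) (𝓝 L) := by
  set K : ℝ × ℝ → ℝ := fun p => k p.1 p.2 with hK
  set K₁ : ℝ × ℝ → ℝ := fun p => fderiv ℝ K p (1, 0) with hK₁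
  set K₁₂ : ℝ × ℝ → ℝ := fun p => fderiv ℝ K₁ p (0, 1) with hK₁₂
  have hK₁c : ContDiff ℝ 1 K₁ :=
    (hk.fderiv_right (m := 1) (by norm_num)).clm_apply contDiff_const
  have hK₁₂c : Continuous K₁₂ :=
    (hK₁c.continuous_fderiv (by norm_num)).clm_apply continuous_const
  have hd₁ (s t : ℝ) : HasDerivAt (fun s => k s t) (K₁ (s, t)) s :=
    ((hk.differentiable (by norm_num)) (s, t)).hasFDerivAt.comp_hasDerivAt (f := fun s => (s, t)) s
      ((hasDerivAt_id s).prodMk (hasDerivAt_const s t))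
  have hd₂ (s t : ℝ) : HasDerivAt (fun t => K₁ (s, t)) (K₁₂ (s, t)) t :=
    ((hK₁c.differentiable (by norm_num)) (s, t)).hasFDerivAt.comp_hasDerivAt
      (f := fun t => (s, t)) t ((hasDerivAt_const t s).prodMk (hasDerivAt_id t))
  set L := K₁₂ (x, y) with hL
  refine ⟨L, Metric.tendsto_nhds.2 fun ε hε => ?_⟩
  obtain ⟨r, hr, hball⟩ := Metric.continuousAt_iff.1 hK₁₂c.continuousAt (ε / 2) (half_pos hε)
  have hnear : ∀ᶠ δ : ℝ in 𝓝[≠] 0, |δ| < r ∧ δ ≠ 0 := by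
    refine Filter.Eventually.and ?_ self_mem_nhdsWithin
    refine mem_nhdsWithin_of_mem_nhds ?_
    filter_upwards [Metric.ball_mem_nhds (0 : ℝ) hr] with δ hδ
    simpa using hδ
  filter_upwards [hnear.prod_mk hnear] with p hp
  obtain ⟨⟨h1, h1'⟩, h2, h2'⟩ := hp
  have hbound₂ (s : ℝ) (hs : s ∈ Metric.ball x r) :
      ‖K₁ (s, y + p.2) - K₁ (s, y) - p.2 * L‖ ≤ ε / 2 * |p.2| := by
    have := (convex_ball y r).norm_image_sub_le_of_norm_hasDerivWithin_le
      (f := fun t => K₁ (s, t) - t * L) (f' := fun t => K₁₂ (s, t) - 1 * L) (C := ε / 2)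
      (x := y) (y := y + p.2)
      (fun t _ => ((hd₂ s t).sub ((hasDerivAt_id t).mul_const L)).hasDerivWithinAt)
      (fun t ht => by
        have hst : Dist.dist (s, t) (x, y) < r := by
          rw [Prod.dist_eq]
          exact max_lt hs ht
        have := hball hst
        rw [one_mul, ← dist_eq_norm]
        exact this.le)
      (Metric.mem_ball_self hr) (by simpa using h2)
    rw [add_sub_cancel_left, Real.norm_eq_abs p.2] at this
    rwa [show K₁ (s, y + p.2) - (y + p.2) * L - (K₁ (s, y) - y * L)
      = K₁ (s, y + p.2) - K₁ (s, y) - p.2 * L by ring] at this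
  have hbound₁ := (convex_ball x r).norm_image_sub_le_of_norm_hasDerivWithin_le
      (f := fun s => k s (y + p.2) - k s y - s * (p.2 * L))
      (f' := fun s => K₁ (s, y + p.2) - K₁ (s, y) - 1 * (p.2 * L)) (C := ε / 2 * |p.2|)
      (x := x) (y := x + p.1)
      (fun s _ => (((hd₁ s (y + p.2)).sub (hd₁ s y)).sub
        ((hasDerivAt_id s).mul_const (p.2 * L))).hasDerivWithinAt)
      (fun s hs => by simpa only [one_mul] using hbound₂ s hs)
      (Metric.mem_ball_self hr) (by simpa using h1)
  rw [add_sub_cancel_left, Real.norm_eq_abs, Real.norm_eq_abs] at hbound₁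
  have hpos : 0 < |p.1 * p.2| := abs_pos.2 (mul_ne_zero h1' h2')
  have hquot : (k (x + p.1) (y + p.2) - k (x + p.1) y - k x (y + p.2) + k x y) / (p.1 * p.2) - L
      = (k (x + p.1) (y + p.2) - k (x + p.1) y - (x + p.1) * (p.2 * L)
        - (k x (y + p.2) - k x y - x * (p.2 * L))) / (p.1 * p.2) := by
    field_simp
    ring
  rw [Real.dist_eq, hquot, abs_div, div_lt_iff₀ hpos]
  refine hbound₁.trans_lt ?_
  rw [abs_mul] at hpos ⊢
  nlinarith

/-- A curve in a Hilbert space whose Gram kernel is `C²` is differentiable. -/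
theorem differentiable_of_contDiff_inner {H : Type*} [NormedAddCommGroup H]
    [InnerProductSpace ℝ H] [CompleteSpace H] {G : ℝ → H}
    (hG : ContDiff ℝ 2 (fun p : ℝ × ℝ => inner ℝ (G p.1) (G p.2))) : Differentiable ℝ G := by
  intro x
  set q : ℝ → H := fun δ => δ⁻¹ • (G (x + δ) - G x) with hq
  obtain ⟨L, hL⟩ := ContDiff.exists_tendsto_mixed_difference_quotient
    (k := fun s t => inner ℝ (G s) (G t)) hG x x
  have hinner : Tendsto (fun p : ℝ × ℝ => inner ℝ (q p.1) (q p.2))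
      (𝓝[≠] 0 ×ˢ 𝓝[≠] 0) (𝓝 L) := by
    refine hL.congr fun p => ?_
    simp only [hq, real_inner_smul_left, real_inner_smul_right, inner_sub_left, inner_sub_right,
      div_eq_mul_inv, mul_inv]
    ring
  have hdiag : Tendsto (fun δ : ℝ => inner ℝ (q δ) (q δ)) (𝓝[≠] 0) (𝓝 L) :=
    hinner.comp (tendsto_id.prodMk tendsto_id)
  have hsq : Tendsto (fun p : ℝ × ℝ => ‖q p.1 - q p.2‖ ^ 2) (𝓝[≠] 0 ×ˢ 𝓝[≠] 0) (𝓝 0) := by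
    have h := ((hdiag.comp tendsto_fst).sub (hinner.const_mul 2)).add (hdiag.comp tendsto_snd)
    rw [show L - 2 * L + L = 0 by ring] at h
    refine h.congr fun p => ?_
    simp only [Function.comp_apply, norm_sub_sq_real, real_inner_self_eq_norm_sq]
  have hcauchy : Cauchy (map q (𝓝[≠] 0)) := by
    refine cauchy_map_iff.2 ⟨inferInstance, tendsto_uniformity_iff_dist_tendsto_zero.2 ?_⟩
    simpa [dist_eq_norm, Real.sqrt_sq] using hsq.sqrt
  obtain ⟨D, hD⟩ := CompleteSpace.complete hcauchy
  exact (hasDerivAt_iff_tendsto_slope_zero.2 hD).differentiableAt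

/-- Existence of the derivative random field: the difference quotients of a Gaussian
random field with differentiable mean and C² covariance converge in mean square. -/
theorem statement3 {Ω : Type*} [MeasurableSpace Ω] (P : Measure Ω) [IsProbabilityMeasure P]
    (f : ℝ → Ω → ℝ) (m : ℝ → ℝ) (k : ℝ → ℝ → ℝ)
    (hf : IsGaussianRF P f)
    (hm : ∀ x, m x = ∫ ω, f x ω ∂P)
    (hk : ∀ x x', k x x' = ∫ ω, (f x ω - m x) * (f x' ω - m x') ∂P)
    (hmd : Differentiable ℝ m)
    (hkd : ContDiff ℝ 2 (fun p : ℝ × ℝ => k p.1 p.2)) :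
    ∃ Df : ℝ → Ω → ℝ, IsDerivField P f Df := by
  let F : ℝ → Lp ℝ 2 P := fun x => (hf.memLp_two x).toLp (f x)
  let one : Lp ℝ 2 P := (memLp_const (1 : ℝ)).toLp (fun _ => 1)
  let G : ℝ → Lp ℝ 2 P := fun x => F x - m x • one
  have hGcoe (x : ℝ) : G x =ᵐ[P] fun ω => f x ω - m x := by
    filter_upwards [Lp.coeFn_sub (F x) (m x • one), Lp.coeFn_smul (m x) one,
      (hf.memLp_two x).coeFn_toLp, (memLp_const (1 : ℝ)).coeFn_toLp (p := 2) (μ := P)]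
      with ω h1 h2 h3 h4
    rw [h1, Pi.sub_apply, h2, Pi.smul_apply, h3, h4, smul_eq_mul, mul_one]
  have hGinner (x y : ℝ) : inner ℝ (G x) (G y) = k x y := by
    rw [L2.inner_def, hk]
    refine integral_congr_ae ?_
    filter_upwards [hGcoe x, hGcoe y] with ω h1 h2
    rw [h1, h2, RCLike.inner_apply, conj_trivial, mul_comm]
  have hGd : Differentiable ℝ G := differentiable_of_contDiff_inner (by simpa only [hGinner])
  have hFd : Differentiable ℝ F := by
    have h := hGd.add (hmd.smul_const one)
    rwa [show (G + fun x => m x • one) = F from funext fun x => sub_add_cancel _ _] at h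
  refine ⟨fun x => ⇑(deriv F x), fun x => (Lp.stronglyMeasurable (deriv F x)).measurable, fun x => ?_⟩
  have hlim := ((hFd x).hasDerivAt.tendsto_slope_zero.sub_const (deriv F x)).norm.pow 2
  rw [sub_self, norm_zero, zero_pow two_ne_zero] at hlim
  refine hlim.congr fun δ => ?_
  rw [← real_inner_self_eq_norm_sq, L2.inner_def]
  refine integral_congr_ae ?_
  filter_upwards [Lp.coeFn_sub (δ⁻¹ • (F (x + δ) - F x)) (deriv F x),
    Lp.coeFn_smul δ⁻¹ (F (x + δ) - F x), Lp.coeFn_sub (F (x + δ)) (F x),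
    (hf.memLp_two (x + δ)).coeFn_toLp, (hf.memLp_two x).coeFn_toLp] with ω h1 h2 h3 h4 h5
  rw [h1, Pi.sub_apply, h2, Pi.smul_apply, h3, Pi.sub_apply, h4, h5, real_inner_self_eq_norm_sq,
    Real.norm_eq_abs, sq_abs, smul_eq_mul, div_eq_inv_mul]
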